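/- Let y ∈ {0,1}^C be a binary label vector with at least one relevant label, σ a permutation of {1,…,C}, C_P the number of relevant labels of y, C_A = max{σ(i) : y_i = 1}, and T ≥ 1 a natural number. Then the total Sort-and-add runtime is upper bounded in terms of the rank loss: 1^T + 2^T + ⋯ + C_A^T ≤ C · (C_P + L_r(y, σ))^T. Hence for fixed program length T, the total runtime of a Sort-and-add search scheme is upper bounded by a monotone function of the rank loss of the ranking used. -/

import Mathlib

/-- The rank loss of a binary label vector `y : Fin C → Bool` with respect to a ranking
given by a permutation `σ` (where `σ i` is the rank of label `i`, smaller ranks ranked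
higher): the number of ordered pairs `(i, j)` with `y i = 1`, `y j = 0` and `σ j < σ i`. -/
def rankLoss {C : ℕ} (y : Fin C → Bool) (σ : Equiv.Perm (Fin C)) : ℕ :=
  (Finset.univ.filter
    (fun p : Fin C × Fin C => y p.1 = true ∧ y p.2 = false ∧ σ p.2 < σ p.1)).card

theorem rank_le_card_relevant_add_rankLoss {C : ℕ} (y : Fin C → Bool)
    (σ : Equiv.Perm (Fin C)) {i : Fin C} (hi : y i = true) :
    (σ i : ℕ) + 1 ≤
      (Finset.univ.filter (fun i : Fin C => y i = true)).card + rankLoss y σ := by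
  set R := Finset.univ.filter (fun j : Fin C => y j = true)
  set N := Finset.univ.filter (fun j : Fin C => y j = false ∧ σ j < σ i)
  have hN : N.card ≤ rankLoss y σ :=
    Finset.card_le_card_of_injOn (fun j => (i, j)) (fun j hj => by simp_all [N])
      (fun j _ k _ h => (Prod.mk.inj h).2)
  calc (σ i : ℕ) + 1 = ((Finset.Iic (σ i)).map σ.symm.toEmbedding).card := by simp
    _ ≤ (R ∪ N).card := by
      refine Finset.card_le_card fun j hj => ?_
      have hle : σ j ≤ σ i := by simpa [Finset.mem_map_equiv] using hj
      cases hyj : y j with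
      | true => simp [R, hyj]
      | false =>
        have hne : σ j ≠ σ i := fun h => by simp_all [σ.injective h]
        simp [R, N, hyj, lt_of_le_of_ne hle hne]
    _ ≤ R.card + N.card := Finset.card_union_le R N
    _ ≤ R.card + rankLoss y σ := Nat.add_le_add_left hN _

/-- The total Sort-and-add runtime `1^T + 2^T + ⋯ + C_A^T` (with `C_A` the maximal rank
`σ i + 1 ∈ {1,…,C}` of a relevant label of `y`) is upper bounded in terms of the rank loss:
it is at most `C * (C_P + L_r(y, σ))^T`, where `C_P` is the number of relevant labels.
Hence for fixed `T` the total runtime is bounded by a monotone function of the rank loss. -/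
theorem sort_and_add_runtime_le_rankLoss_bound
    {C : ℕ} (y : Fin C → Bool) (σ : Equiv.Perm (Fin C)) (hy : ∃ i, y i = true)
    (T : ℕ) (hT : 1 ≤ T) :
    (∑ k ∈ Finset.Icc 1
        ((Finset.univ.filter (fun i : Fin C => y i = true)).sup (fun i => (σ i : ℕ) + 1)),
      k ^ T) ≤
      C * ((Finset.univ.filter (fun i : Fin C => y i = true)).card + rankLoss y σ) ^ T := by
  set A := (Finset.univ.filter (fun i : Fin C => y i = true)).sup (fun i => (σ i : ℕ) + 1)
  have hAC : A ≤ C := Finset.sup_le fun i _ => (σ i).isLt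
  have hA : A ≤ (Finset.univ.filter (fun i : Fin C => y i = true)).card + rankLoss y σ :=
    Finset.sup_le fun i hi =>
      rank_le_card_relevant_add_rankLoss y σ (Finset.mem_filter.mp hi).2
  calc ∑ k ∈ Finset.Icc 1 A, k ^ T ≤ (Finset.Icc 1 A).card • A ^ T :=
        Finset.sum_le_card_nsmul _ _ _ fun k hk =>
          Nat.pow_le_pow_left (Finset.mem_Icc.mp hk).2 T
    _ = A * A ^ T := by simp
    _ ≤ _ := Nat.mul_le_mul hAC (Nat.pow_le_pow_left hA T)
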